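/- Let k ≥ 2 be a fixed integer and set c = (π/16)·2^{1/k}. Then there exist a function m : ℕ → ℕ and, for every sufficiently large positive integer r, a set D(r) ⊆ ℤ² that is a DD(m(r), r) with maximal k-hop coverage (|D(r)| = m(r), all pairwise differences between distinct points of D(r) are distinct, pairwise Euclidean distances are at most r, and C_k(D(r)) = ∑_{i=1}^k |H_i| with H_i defined for m(r)-tuples), such that m(r)/r^{1/k} → c as r → ∞. -/

import Mathlib

/-- All differences of distinct pairs of points of `D` are pairwise distinct. -/
def HasDistinctDifferences {G : Type*} [AddCommGroup G] (D : Set G) : Prop :=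
  ∀ v ∈ D, ∀ w ∈ D, ∀ v' ∈ D, ∀ w' ∈ D,
    v ≠ w → v' ≠ w' → v - w = v' - w' → v = v' ∧ w = w'

/-- The set of nonzero elements expressible as a sum of at most `k` difference
vectors of `D`. -/
def khopSet {G : Type*} [AddCommGroup G] (D : Set G) (k : ℕ) : Set G :=
  {x | x ≠ 0 ∧ ∃ ℓ : ℕ, ℓ ≤ k ∧ ∃ a b : Fin ℓ → G,
    (∀ i, a i ∈ D ∧ b i ∈ D ∧ a i ≠ b i) ∧ x = ∑ i, (a i - b i)}

/-- `Ck D k` is the `k`-hop coverage of `D`. -/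
noncomputable def Ck {G : Type*} [AddCommGroup G] (D : Set G) (k : ℕ) : ℕ :=
  (khopSet D k).ncard

/-- `H m k` is the set of m-tuples of integers summing to 0 whose positive
entries sum to `k`. -/
def H (m k : ℕ) : Set (Fin m → ℤ) :=
  {a | ∑ i, a i = 0 ∧ ∑ i ∈ Finset.univ.filter (fun i => 0 < a i), a i = (k : ℤ)}

/-- The Euclidean distance between two points of ℤ². -/
noncomputable def euclDistZ (p q : ℤ × ℤ) : ℝ :=
  Real.sqrt (((p.1 - q.1 : ℤ) : ℝ) ^ 2 + ((p.2 - q.2 : ℤ) : ℝ) ^ 2)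

/-- The sum of the positive entries of an integer vector. -/
def positiveSum {ι : Type*} [Fintype ι] (u : ι → ℤ) : ℕ := ∑ i, (u i).toNat

/-- A family `e` is independent up to level `h` if it satisfies no nontrivial integer relation
with zero coefficient sum whose positive coefficients sum to at most `h`. Equivalently, its sums
of `h` terms are pairwise distinct. -/
def IndependentUpTo {ι G : Type*} [Fintype ι] [AddCommGroup G] (h : ℕ) (e : ι → G) : Prop :=
  ∀ u : ι → ℤ, ∑ i, u i = 0 → positiveSum u ≤ h → ∑ i, u i • e i = 0 → u = 0

section positiveSum

variable {ι : Type*} [Fintype ι]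

theorem positiveSum_add_le (u v : ι → ℤ) :
    positiveSum (u + v) ≤ positiveSum u + positiveSum v := by
  unfold positiveSum
  rw [← Finset.sum_add_distrib]
  exact Finset.sum_le_sum fun i _ => by simp only [Pi.add_apply]; omega

theorem positiveSum_neg {u : ι → ℤ} (hu : ∑ i, u i = 0) :
    positiveSum (-u) = positiveSum u := by
  have h : ((positiveSum u : ℕ) : ℤ) - (positiveSum (-u) : ℕ) = ∑ i, u i := by
    unfold positiveSum
    push_cast
    rw [← Finset.sum_sub_distrib]
    exact Finset.sum_congr rfl fun i _ => by simp only [Pi.neg_apply]; omega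
  omega

theorem positiveSum_sum_le {κ : Type*} (s : Finset κ) (f : κ → ι → ℤ) :
    positiveSum (∑ t ∈ s, f t) ≤ ∑ t ∈ s, positiveSum (f t) := by
  induction s using Finset.cons_induction with
  | empty => simp [positiveSum]
  | cons a s ha ih =>
    rw [Finset.sum_cons, Finset.sum_cons]
    exact (positiveSum_add_le _ _).trans (by omega)

theorem positiveSum_single_sub_single_le [DecidableEq ι] (i j : ι) :
    positiveSum (Pi.single i 1 - Pi.single j 1 : ι → ℤ) ≤ 1 := by
  calc positiveSum (Pi.single i 1 - Pi.single j 1 : ι → ℤ)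
      ≤ ∑ l, (if l = i then 1 else 0) := Finset.sum_le_sum fun l _ => by
        simp only [Pi.sub_apply, Pi.single_apply]; split_ifs <;> simp
    _ = 1 := by simp

theorem sum_single_sub_single [DecidableEq ι] (i j : ι) :
    ∑ l, (Pi.single i 1 - Pi.single j 1 : ι → ℤ) l = 0 := by
  simp

theorem sum_single_sub_single_smul [DecidableEq ι] {G : Type*} [AddCommGroup G] (e : ι → G)
    (i j : ι) : ∑ l, (Pi.single i 1 - Pi.single j 1 : ι → ℤ) l • e l = e i - e j := by
  simp [sub_smul, Pi.single_apply, ite_smul]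

theorem eq_zero_of_positiveSum_eq_zero {u : ι → ℤ} (hu : ∑ i, u i = 0)
    (h : positiveSum u = 0) : u = 0 := by
  have h' := positiveSum_neg hu
  rw [h] at h'
  unfold positiveSum at h h'
  rw [Finset.sum_eq_zero_iff] at h h'
  ext i
  have h1 := h i (Finset.mem_univ i)
  have h2 := h' i (Finset.mem_univ i)
  simp only [Pi.neg_apply] at h2
  simp only [Pi.zero_apply]
  omega

theorem mem_H_iff {m k : ℕ} {u : Fin m → ℤ} :
    u ∈ H m k ↔ ∑ i, u i = 0 ∧ positiveSum u = k := by
  have h : ∑ i ∈ Finset.univ.filter (fun i => 0 < u i), u i = (positiveSum u : ℤ) := by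
    unfold positiveSum
    push_cast
    rw [Finset.sum_filter]
    exact Finset.sum_congr rfl fun i _ => by split_ifs <;> omega
  simp only [H, Set.mem_ofPred_eq, h, Nat.cast_inj]

theorem finite_H (m k : ℕ) : (H m k).Finite := by
  refine (Set.finite_Icc (fun _ => -(k : ℤ)) (fun _ => (k : ℤ))).subset fun u hu => ?_
  obtain ⟨h0, h1⟩ := mem_H_iff.1 hu
  have h2 := positiveSum_neg h0
  have key : ∀ (v : Fin m → ℤ) i, v i ≤ positiveSum v := fun v i => by
    have : (v i).toNat ≤ positiveSum v :=
      Finset.single_le_sum (f := fun i => (v i).toNat) (fun _ _ => Nat.zero_le _)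
        (Finset.mem_univ i)
    omega
  constructor <;> intro i
  · have := key (-u) i
    simp only [Pi.neg_apply] at this
    show -(k : ℤ) ≤ u i
    omega
  · have := key u i
    show u i ≤ k
    omega

/-- A vector with zero sum is a sum of `positiveSum u` differences of basis vectors. -/
theorem exists_decomposition [DecidableEq ι] (n : ℕ) (u : ι → ℤ) (hu : ∑ i, u i = 0)
    (hn : positiveSum u = n) :
    ∃ a b : Fin n → ι, (∀ t, 0 < u (a t) ∧ u (b t) < 0) ∧
      u = ∑ t, (Pi.single (a t) 1 - Pi.single (b t) 1 : ι → ℤ) := by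
  induction n generalizing u with
  | zero =>
    exact ⟨Fin.elim0, Fin.elim0, fun t => t.elim0, by
      simpa using eq_zero_of_positiveSum_eq_zero hu hn⟩
  | succ n ih =>
    have hpos : ∀ v : ι → ℤ, positiveSum v = n + 1 → ∃ i, 0 < v i := by
      intro v hv
      by_contra! hc
      have : positiveSum v = 0 :=
        Finset.sum_eq_zero fun i _ => by have := hc i; omega
      omega
    obtain ⟨i, hi⟩ := hpos u hn
    obtain ⟨j, hj⟩ := hpos (-u) ((positiveSum_neg hu).trans hn)
    simp only [Pi.neg_apply, Left.neg_pos_iff] at hj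
    have hij : i ≠ j := by rintro rfl; omega
    set w : ι → ℤ := u - (Pi.single i 1 - Pi.single j 1) with hw
    have hw0 : ∑ l, w l = 0 := by
      rw [hw]
      simp only [Pi.sub_apply (u)]
      rw [Finset.sum_sub_distrib, hu, sum_single_sub_single, sub_zero]
    have hwn : positiveSum w = n := by
      have : positiveSum u = positiveSum w + ∑ l, (if l = i then 1 else 0) := by
        unfold positiveSum
        rw [← Finset.sum_add_distrib]
        refine Finset.sum_congr rfl fun l _ => ?_
        simp only [hw, Pi.sub_apply, Pi.single_apply]
        split_ifs with h1 h2 h2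
        · exact absurd (h1.symm.trans h2) hij
        · subst h1; omega
        · subst h2; omega
        · omega
      simp at this
      omega
    obtain ⟨a, b, hab, hsum⟩ := ih w hw0 hwn
    refine ⟨Fin.cons i a, Fin.cons j b, ?_, ?_⟩
    · have hwl : ∀ l, w l = u l - ((if l = i then 1 else 0) - (if l = j then 1 else 0)) :=
        fun l => by simp [hw, Pi.single_apply]
      refine Fin.cases ⟨hi, hj⟩ fun t => ?_
      obtain ⟨h1, h2⟩ := hab t
      rw [hwl] at h1 h2
      simp only [Fin.cons_succ]
      constructor
      · by_cases h : a t = j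
        · rw [h] at h1; simp [hij.symm] at h1; omega
        · rw [if_neg h] at h1; split_ifs at h1 <;> omega
      · by_cases h : b t = i
        · rw [h] at h2; simp [hij] at h2; omega
        · rw [if_neg h] at h2; split_ifs at h2 <;> omega
    · rw [Fin.sum_univ_succ]
      simp only [Fin.cons_zero, Fin.cons_succ]
      rw [← hsum, hw]
      abel

end positiveSum

namespace IndependentUpTo

variable {ι G : Type*} [Fintype ι] [AddCommGroup G] {h k : ℕ} {e : ι → G}

theorem of_comp {G' : Type*} [AddCommGroup G'] (φ : G →+ G') (he : IndependentUpTo h (φ ∘ e)) :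
    IndependentUpTo h e := fun u h0 h1 h2 => he u h0 h1 (by
  have := congrArg φ h2
  simpa [map_sum, map_zsmul] using this)

theorem mono {h' : ℕ} (he : IndependentUpTo h e) (hh : h' ≤ h) : IndependentUpTo h' e :=
  fun u h0 h1 h2 => he u h0 (h1.trans hh) h2

theorem eq_of_sum_smul_eq (he : IndependentUpTo (2 * k) e) {u v : ι → ℤ}
    (hu : ∑ i, u i = 0) (hv : ∑ i, v i = 0) (hku : positiveSum u ≤ k) (hkv : positiveSum v ≤ k)
    (huv : ∑ i, u i • e i = ∑ i, v i • e i) : u = v := by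
  refine sub_eq_zero.1 (he (u - v) ?_ ?_ ?_)
  · simp [Finset.sum_sub_distrib, hu, hv]
  · have := positiveSum_add_le u (-v)
    rw [positiveSum_neg hv, ← sub_eq_add_neg] at this
    omega
  · simp [sub_smul, Finset.sum_sub_distrib, huv]

theorem injective (he : IndependentUpTo h e) (hh : 1 ≤ h) : Function.Injective e := by
  classical
  intro i j hij
  have := he _ (sum_single_sub_single i j) ((positiveSum_single_sub_single_le i j).trans hh)
    (by rw [sum_single_sub_single_smul, hij, sub_self])
  have := congrFun this i
  by_contra hne
  simp [hne] at this

theorem hasDistinctDifferences (he : IndependentUpTo 2 e) :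
    HasDistinctDifferences (Set.range e) := by
  classical
  rintro _ ⟨i, rfl⟩ _ ⟨j, rfl⟩ _ ⟨i', rfl⟩ _ ⟨j', rfl⟩ hij hij' heq
  have hne : i ≠ j := fun h => hij (congrArg e h)
  have hne' : i' ≠ j' := fun h => hij' (congrArg e h)
  have := (he : IndependentUpTo (2 * 1) e).eq_of_sum_smul_eq
    (sum_single_sub_single i j) (sum_single_sub_single i' j')
    (positiveSum_single_sub_single_le i j) (positiveSum_single_sub_single_le i' j')
    (by rw [sum_single_sub_single_smul, sum_single_sub_single_smul, heq])
  have h1 := congrFun this i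
  have h2 := congrFun this j
  simp only [Pi.sub_apply, Pi.single_apply, if_true, if_neg hne, if_neg hne.symm] at h1 h2
  have hi : i = i' := by
    by_contra hc
    rw [if_neg hc] at h1
    split_ifs at h1 <;> omega
  have hj : j = j' := by
    by_contra hc
    rw [if_neg hc] at h2
    split_ifs at h2 <;> omega
  exact ⟨congrArg e hi, congrArg e hj⟩

theorem khopSet_range {m : ℕ} {e : Fin m → G} (he : IndependentUpTo (2 * k) e) :
    khopSet (Set.range e) k =
      (fun u : Fin m → ℤ => ∑ i, u i • e i) '' ⋃ i ∈ Finset.Icc 1 k, H m i := by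
  ext x
  simp only [khopSet, Set.mem_ofPred_eq, Set.mem_image, Set.mem_iUnion, Finset.mem_Icc]
  constructor
  · rintro ⟨hx, l, hl, a, b, hab, rfl⟩
    choose i hi using fun t => (hab t).1
    choose j hj using fun t => (hab t).2.1
    set u : Fin m → ℤ := ∑ t, (Pi.single (i t) 1 - Pi.single (j t) 1 : Fin m → ℤ) with hu
    have hu0 : ∑ s, u s = 0 := by
      simp only [hu, Finset.sum_apply]
      rw [Finset.sum_comm]
      exact Finset.sum_eq_zero fun t _ => sum_single_sub_single _ _
    have hue : ∑ s, u s • e s = ∑ t, (a t - b t) := by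
      simp only [hu, Finset.sum_apply, Finset.sum_smul]
      rw [Finset.sum_comm]
      exact Finset.sum_congr rfl fun t _ => by
        rw [sum_single_sub_single_smul, hi, hj]
    have hul : positiveSum u ≤ l := by
      refine (positiveSum_sum_le _ _).trans
        ((Finset.sum_le_sum fun t _ => positiveSum_single_sub_single_le _ _).trans ?_)
      simp
    refine ⟨u, ⟨positiveSum u, ⟨?_, hul.trans hl⟩, mem_H_iff.2 ⟨hu0, rfl⟩⟩, hue⟩
    by_contra hc
    have := eq_zero_of_positiveSum_eq_zero hu0 (by omega)
    exact hx (by rw [← hue, this]; simp)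
  · rintro ⟨u, ⟨n, ⟨hn1, hnk⟩, hun⟩, rfl⟩
    obtain ⟨hu0, hun⟩ := mem_H_iff.1 hun
    refine ⟨fun hzero => ?_, n, hnk, ?_⟩
    · have := he u hu0 (by omega) hzero
      rw [this] at hun
      simp [positiveSum] at hun
      omega
    · obtain ⟨a, b, hab, hsum⟩ := exists_decomposition n u hu0 hun
      refine ⟨fun t => e (a t), fun t => e (b t),
        fun t => ⟨⟨_, rfl⟩, ⟨_, rfl⟩, fun heq => ?_⟩, ?_⟩
      · have := he.injective (by omega) heq
        have h1 := hab t
        rw [this] at h1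
        omega
      · conv_lhs => rw [hsum]
        simp only [Finset.sum_apply, Finset.sum_smul]
        rw [Finset.sum_comm]
        exact Finset.sum_congr rfl fun t _ => sum_single_sub_single_smul _ _ _

theorem Ck_range {m : ℕ} {e : Fin m → G} (he : IndependentUpTo (2 * k) e) :
    Ck (Set.range e) k = ∑ i ∈ Finset.Icc 1 k, (H m i).ncard := by
  have hinj : Set.InjOn (fun u : Fin m → ℤ => ∑ i, u i • e i)
      (⋃ i ∈ Finset.Icc 1 k, H m i) := by
    intro u hu v hv huv
    simp only [Set.mem_iUnion, Finset.mem_Icc, mem_H_iff] at hu hv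
    obtain ⟨i, hi, hu0, hui⟩ := hu
    obtain ⟨j, hj, hv0, hvj⟩ := hv
    exact he.eq_of_sum_smul_eq hu0 hv0 (by omega) (by omega) huv
  have hdisj : Set.PairwiseDisjoint (Finset.Icc 1 k : Set ℕ) (H m) := by
    intro i _ j _ hij
    refine Set.disjoint_left.2 fun u hu hv => hij ?_
    rw [← (mem_H_iff.1 hu).2, ← (mem_H_iff.1 hv).2]
  rw [Ck, he.khopSet_range, hinj.ncard_image]
  classical
  have hcoe : (⋃ i ∈ Finset.Icc 1 k, H m i) =
      ((Finset.Icc 1 k).biUnion fun i => (finite_H m i).toFinset : Finset (Fin m → ℤ)) := by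
    ext; simp
  rw [hcoe, Set.ncard_coe_finset, Finset.card_biUnion]
  · exact Finset.sum_congr rfl fun i _ => (Set.ncard_eq_toFinset_card _ (finite_H m i)).symm
  · intro i hi j hj hij
    simpa using hdisj hi hj hij

end IndependentUpTo

/-- **Bose–Chowla**: shifts of an element `θ` generating an extension of degree `h` admit no
multiplicative relation of degree at most `h`; discrete logarithms give integers. -/
theorem exists_independentUpTo_nat (p h m : ℕ) (hp : p.Prime) (hh : 2 ≤ h) (hm : m ≤ p) :
    ∃ d : Fin m → ℕ, (∀ i, d i < p ^ h) ∧ IndependentUpTo h (fun i => (d i : ℤ)) := by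
  open Polynomial in
  have : Fact p.Prime := ⟨hp⟩
  let F := ZMod p
  let K := GaloisField p h
  have hfin : Module.finrank F K = h := GaloisField.finrank p (by omega)
  have hcard : Nat.card K = p ^ h := GaloisField.card p h (by omega)
  obtain ⟨θ, hθ⟩ := Field.exists_primitive_element F K
  have hint : IsIntegral F θ := Algebra.IsIntegral.isIntegral θ
  have hdeg : (minpoly F θ).natDegree = h := by
    rw [← IntermediateField.adjoin.finrank hint, hθ, IntermediateField.finrank_top', hfin]
  have small : ∀ P : F[X], P.natDegree < h → aeval θ P = 0 → P = 0 := by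
    intro P hP h0
    by_contra hne
    exact absurd (natDegree_le_natDegree (minpoly.degree_le_of_ne_zero F θ hne h0)) (by omega)
  let c : Fin m → F := fun i => (i : ℕ)
  have hc : Function.Injective c := by
    intro i j hij
    have := (ZMod.natCast_eq_natCast_iff' _ _ _).1 hij
    rw [Nat.mod_eq_of_lt (i.2.trans_le hm), Nat.mod_eq_of_lt (j.2.trans_le hm)] at this
    exact Fin.ext this
  have hne : ∀ i, θ - algebraMap F K (c i) ≠ 0 := by
    intro i h0
    refine X_sub_C_ne_zero (c i) (small _ ?_ ?_)
    · rw [natDegree_X_sub_C]; omega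
    · simpa using h0
  obtain ⟨g, hg⟩ := IsCyclic.exists_generator (α := Kˣ)
  have hlog : ∀ x : Kˣ, ∃ n : ℕ, n < p ^ h ∧ g ^ n = x := by
    intro x
    classical
    obtain ⟨n, hn, hx⟩ := (isOfFinOrder_of_finite g).mem_zpowers_iff_mem_range_orderOf.1 (hg x)
      |> Finset.mem_image.1
    refine ⟨n, (Finset.mem_range.1 hn).trans_le ?_, hx⟩
    rw [← hcard]
    exact (orderOf_le_card).trans (Nat.card_le_card_of_injective _ Units.val_injective)
  choose d hd hgd using fun i => hlog (Units.mk0 _ (hne i))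
  refine ⟨d, hd, fun u h0 h1 h2 => ?_⟩
  let P : (Fin m → ℤ) → F[X] := fun v => ∏ i, (X - C (c i)) ^ (v i).toNat
  have hPmonic : ∀ v, (P v).Monic := fun v =>
    monic_prod_of_monic _ _ fun i _ => (monic_X_sub_C _).pow _
  have hPdeg : ∀ v, (P v).natDegree = positiveSum v := fun v => by
    rw [natDegree_prod_of_monic _ _ fun i _ => (monic_X_sub_C _).pow _]
    simp [positiveSum]
  have hPval : ∀ v, aeval θ (P v) = ((g ^ (∑ i, d i * (v i).toNat) : Kˣ) : K) := fun v => by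
    rw [← Finset.prod_pow_eq_pow_sum]
    simp only [pow_mul, hgd]
    simp [P]
  have hlogs : ∑ i, d i * (u i).toNat = ∑ i, d i * ((-u) i).toNat := by
    zify
    rw [← sub_eq_zero, ← Finset.sum_sub_distrib, ← h2]
    refine Finset.sum_congr rfl fun i _ => ?_
    rw [← mul_sub, smul_eq_mul, mul_comm]
    congr 1
    simp only [Pi.neg_apply]
    omega
  have hPeq : P u = P (-u) := by
    by_contra hPne
    have hd' : (P u).degree = (P (-u)).degree := by
      rw [degree_eq_natDegree (hPmonic _).ne_zero, degree_eq_natDegree (hPmonic _).ne_zero,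
        hPdeg, hPdeg, positiveSum_neg h0]
    have hlt := degree_sub_lt_left hd' (hPmonic _).ne_zero
      ((hPmonic u).leadingCoeff.trans (hPmonic (-u)).leadingCoeff.symm)
    refine hPne (sub_eq_zero.1 (small _ ?_ ?_))
    · have := natDegree_lt_natDegree (sub_ne_zero.2 hPne) hlt
      rw [hPdeg] at this
      omega
    · rw [map_sub, hPval, hPval, hlogs, sub_self]
  have hroot : ∀ v i, (P v).rootMultiplicity (c i) = (v i).toNat := fun v i => by
    classical
    rw [← count_roots, roots_prod _ _ (hPmonic v).ne_zero]
    simp only [roots_pow, roots_X_sub_C, Multiset.count_bind, Multiset.count_nsmul,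
      Multiset.count_singleton, hc.eq_iff]
    simp [List.sum_ofFn]
  ext i
  have := hroot u i
  rw [hPeq, hroot] at this
  simp only [Pi.neg_apply] at this
  simp only [Pi.zero_apply]
  omega

theorem euclDistZ_le_of_mem_box {s : ℕ} {r : ℝ} (hr : 0 ≤ r) (hs : 2 * (s : ℝ) ^ 2 ≤ r ^ 2)
    {v w : ℤ × ℤ} (hv : v ∈ Set.Icc 0 ((s : ℤ), (s : ℤ))) (hw : w ∈ Set.Icc 0 ((s : ℤ), (s : ℤ))) :
    euclDistZ v w ≤ r := by
  obtain ⟨⟨hv1, hv2⟩, hv3, hv4⟩ := hv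
  obtain ⟨⟨hw1, hw2⟩, hw3, hw4⟩ := hw
  simp only [Prod.fst_zero, Prod.snd_zero] at *
  have key : ∀ a b : ℤ, 0 ≤ a → 0 ≤ b → a ≤ s → b ≤ s → ((a - b : ℤ) : ℝ) ^ 2 ≤ (s : ℝ) ^ 2 := by
    intro a b ha hb has hbs
    have : (a - b) ^ 2 ≤ (s : ℤ) ^ 2 := sq_le_sq' (by omega) (by omega)
    exact_mod_cast this
  refine Real.sqrt_le_iff.2 ⟨hr, ?_⟩
  linarith [key _ _ hv1 hw1 hv3 hw3, key _ _ hv2 hw2 hv4 hw4]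

/-- Writing the elements of an integer family in base `p ^ k` preserves independence. -/
theorem exists_independentUpTo_box (p k m : ℕ) (hp : p.Prime) (hk : 1 ≤ k) (hm : m ≤ p) :
    ∃ e : Fin m → ℤ × ℤ, (∀ i, e i ∈ Set.Icc 0 (((p ^ k : ℕ) : ℤ), ((p ^ k : ℕ) : ℤ))) ∧
      IndependentUpTo (2 * k) e := by
  obtain ⟨d, hd, hind⟩ := exists_independentUpTo_nat p (2 * k) m hp (by omega) hm
  have hpos : 0 < p ^ k := pow_pos hp.pos k
  refine ⟨fun i => (((d i % p ^ k : ℕ) : ℤ), ((d i / p ^ k : ℕ) : ℤ)), fun i => ?_, ?_⟩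
  · have h1 : d i % p ^ k ≤ p ^ k := (Nat.mod_lt _ hpos).le
    have h2 : d i / p ^ k ≤ p ^ k := by
      refine (Nat.div_lt_of_lt_mul ?_).le
      rw [← pow_add, ← two_mul]
      exact hd i
    refine ⟨⟨?_, ?_⟩, ?_, ?_⟩
    · exact Int.natCast_nonneg _
    · exact Int.natCast_nonneg _
    · exact Int.ofNat_le.2 h1
    · exact Int.ofNat_le.2 h2
  · refine .of_comp (AddMonoidHom.fst ℤ ℤ +
      (AddMonoidHom.mulLeft ((p ^ k : ℕ) : ℤ)).comp (AddMonoidHom.snd ℤ ℤ)) ?_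
    convert hind using 2 with i
    simp only [Function.comp_apply, AddMonoidHom.add_apply, AddMonoidHom.comp_apply,
      AddMonoidHom.coe_fst, AddMonoidHom.coe_snd, AddMonoidHom.coe_mulLeft]
    exact_mod_cast Nat.mod_add_div (d i) (p ^ k)

theorem two_mul_pow_sq_le {k m : ℕ} (hk : 2 ≤ k) {r : ℝ} (hr : 0 ≤ r)
    (hm : (m : ℝ) ≤ Real.pi / 16 * (2 : ℝ) ^ ((1 : ℝ) / k) * r ^ ((1 : ℝ) / k)) :
    2 * (((2 * m) ^ k : ℕ) : ℝ) ^ 2 ≤ r ^ 2 := by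
  have hroot : ∀ x : ℝ, 0 ≤ x → (x ^ ((1 : ℝ) / k)) ^ k = x := fun x hx => by
    rw [one_div, Real.rpow_inv_natCast_pow hx (by omega)]
  have h1 : (2 * (m : ℝ)) ^ k ≤ 1 / 2 * r := by
    calc (2 * (m : ℝ)) ^ k
        ≤ (Real.pi / 8 * (2 : ℝ) ^ ((1 : ℝ) / k) * r ^ ((1 : ℝ) / k)) ^ k :=
          pow_le_pow_left₀ (by positivity) (by linarith) k
      _ = (Real.pi / 8) ^ k * 2 * r := by
          rw [mul_pow, mul_pow, hroot _ (by norm_num), hroot _ hr]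
      _ ≤ (1 / 4) * 2 * r := by
          gcongr
          calc (Real.pi / 8) ^ k ≤ (1 / 2) ^ k :=
                pow_le_pow_left₀ (by positivity) (by linarith [Real.pi_lt_four]) k
            _ ≤ (1 / 2) ^ 2 := pow_le_pow_of_le_one (by norm_num) (by norm_num) hk
            _ = 1 / 4 := by norm_num
      _ = 1 / 2 * r := by ring
  push_cast
  have h2 := pow_le_pow_left₀ (by positivity) h1 2
  nlinarith [sq_nonneg r]

theorem exists_configuration {k : ℕ} (hk : 2 ≤ k) {m : ℕ} {r : ℝ} (hr : 0 ≤ r)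
    (hm : (m : ℝ) ≤ Real.pi / 16 * (2 : ℝ) ^ ((1 : ℝ) / k) * r ^ ((1 : ℝ) / k)) :
    ∃ D : Finset (ℤ × ℤ), D.card = m ∧
      HasDistinctDifferences (D : Set (ℤ × ℤ)) ∧
      (∀ v ∈ D, ∀ w ∈ D, euclDistZ v w ≤ r) ∧
      Ck (D : Set (ℤ × ℤ)) k = ∑ i ∈ Finset.Icc 1 k, (H m i).ncard := by
  suffices ∃ e : Fin m → ℤ × ℤ, (∀ i j, euclDistZ (e i) (e j) ≤ r) ∧
      IndependentUpTo (2 * k) e by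
    obtain ⟨e, hdist, he⟩ := this
    have hcoe : ((Finset.univ.image e : Finset (ℤ × ℤ)) : Set (ℤ × ℤ)) = Set.range e := by simp
    refine ⟨Finset.univ.image e, ?_, ?_, ?_, ?_⟩
    · rw [Finset.card_image_of_injective _ (he.injective (by omega))]; simp
    · rw [hcoe]; exact (he.mono (by omega)).hasDistinctDifferences
    · simpa using fun i j => hdist i j
    · rw [hcoe]; exact he.Ck_range
  rcases Nat.eq_zero_or_pos m with rfl | hpos
  · exact ⟨Fin.elim0, fun i => i.elim0, fun u _ _ _ => Subsingleton.elim _ _⟩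
  · obtain ⟨p, hp, hmp, hpm⟩ := Nat.exists_prime_lt_and_le_two_mul m hpos.ne'
    obtain ⟨e, hbox, he⟩ := exists_independentUpTo_box p k m hp (by omega) hmp.le
    refine ⟨e, fun i j => euclDistZ_le_of_mem_box hr ?_ (hbox i) (hbox j), he⟩
    refine le_trans ?_ (two_mul_pow_sq_le hk hr hm)
    gcongr

theorem stmt12 (k : ℕ) (hk : 2 ≤ k) :
    ∃ (m : ℕ → ℕ) (D : ℕ → Finset (ℤ × ℤ)) (N : ℕ),
      (∀ r : ℕ, N ≤ r →
        (D r).card = m r ∧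
        HasDistinctDifferences (↑(D r) : Set (ℤ × ℤ)) ∧
        (∀ v ∈ D r, ∀ w ∈ D r, euclDistZ v w ≤ (r : ℝ)) ∧
        Ck (↑(D r) : Set (ℤ × ℤ)) k = ∑ i ∈ Finset.Icc 1 k, (H (m r) i).ncard) ∧
      Filter.Tendsto (fun r : ℕ => (m r : ℝ) / (r : ℝ) ^ ((1 : ℝ) / k))
        Filter.atTop
        (nhds (Real.pi / 16 * (2 : ℝ) ^ ((1 : ℝ) / k))) := by
  have hc : 0 ≤ Real.pi / 16 * (2 : ℝ) ^ ((1 : ℝ) / k) := by positivity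
  choose D hD using fun r : ℕ => exists_configuration hk (Nat.cast_nonneg (α := ℝ) r)
    (Nat.floor_le (mul_nonneg hc (Real.rpow_nonneg (Nat.cast_nonneg r) ((1 : ℝ) / k))))
  refine ⟨_, D, 0, fun r _ => hD r, ?_⟩
  have hk0 : (0 : ℝ) < 1 / k := by positivity
  exact (tendsto_nat_floor_mul_div_atTop hc).comp
    ((tendsto_rpow_atTop hk0).comp tendsto_natCast_atTop_atTop)
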